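/- arXiv:1902.03855 — 5 statements merged into one kernel-verified Lean document; each statement's English description precedes it below -/
import Mathlib

section
/- For every finite simple graph A there exists a finite simple graph B which is a coherent EPPA-witness for A; that is, there is a graph embedding ψ : A → B and a map assigning to every partial automorphism φ of ψ(A) an automorphism φ̂ of B extending φ, such that for every coherent triple (f, g, h) of partial automorphisms of ψ(A) one has ĥ = ĝ ∘ f̂. In particular, the class of all finite graphs has coherent EPPA. -/
set_option autoImplicit false

universe u

namespace EPPA

/-- A partial automorphism of the induced subgraph of `G` on the vertex set `S`:
an isomorphism between two induced subgraphs of `G` whose vertex sets `dom` and `ran`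
are contained in `S`. -/
structure GraphPartialAut {V : Type u} (G : SimpleGraph V) (S : Set V) where
  dom : Set V
  ran : Set V
  dom_subset : dom ⊆ S
  ran_subset : ran ⊆ S
  f : V → V
  maps_mem : ∀ x ∈ dom, f x ∈ ran
  injOn : ∀ x ∈ dom, ∀ y ∈ dom, f x = f y → x = y
  surjOn : ∀ y ∈ ran, ∃ x ∈ dom, f x = y
  adj_iff : ∀ x ∈ dom, ∀ y ∈ dom, G.Adj (f x) (f y) ↔ G.Adj x y

/-- `(p, q, r)` form a coherent triple of partial automorphisms:
`Dom p = Dom r`, `Range p = Dom q`, `Range q = Range r` and `r = q ∘ p`. -/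
def GraphCoherentTriple {V : Type u} {G : SimpleGraph V} {S : Set V}
    (p q r : GraphPartialAut G S) : Prop :=
  p.dom = r.dom ∧ p.ran = q.dom ∧ q.ran = r.ran ∧ ∀ x ∈ p.dom, r.f x = q.f (p.f x)

/-- Sets of the same size are matched by permutations that compose coherently. -/
theorem exists_coherent_perm_of_sets (α : Type*) [Finite α] :
    ∃ σ : Set α → Set α → Equiv.Perm α,
      (∀ D R, D.ncard = R.ncard → ∀ x, σ D R x ∈ R ↔ x ∈ D) ∧
        ∀ D R T x, σ R T (σ D R x) = σ D T x := by
  classical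
  have := Fintype.ofFinite α
  have key (S : Set α) :
      ∃ τ : Equiv.Perm α, ∀ x, τ x ∈ Function.invFun Set.ncard S.ncard ↔ x ∈ S := by
    set T : Set α := Function.invFun Set.ncard S.ncard with hT
    have hc : Nat.card S = Nat.card T := (Function.invFun_eq ⟨S, rfl⟩ : T.ncard = S.ncard).symm
    let e : {x // x ∈ S} ≃ {x // x ∈ T} := (Finite.card_eq.mp hc).some
    refine ⟨e.extendSubtype, fun x => ⟨fun h => ?_, e.extendSubtype_mem x⟩⟩
    by_contra hx
    exact e.extendSubtype_not_mem x hx h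
  choose τ hτ using key
  refine ⟨fun D R => (τ D).trans (τ R).symm, fun D R h x => ?_, fun D R T x => by simp⟩
  rw [← hτ R, ← hτ D, h]
  simp

/-- Partial bijections of a finite set extend coherently to permutations. -/
theorem exists_coherent_perm_extension (α : Type*) [Finite α] :
    ∃ E : Set α → Set α → (α → α) → Equiv.Perm α,
      (∀ D R g, Set.BijOn g D R → Set.EqOn (E D R g) g D ∧ ∀ x, E D R g x ∈ R ↔ x ∈ D) ∧
        ∀ D R T g h k, Set.BijOn g D R → Set.BijOn h R T → Set.EqOn k (h ∘ g) D →
          ∀ x, E D T k x = E R T h (E D R g x) := by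
  classical
  obtain ⟨σ, hσ, hcomp⟩ := exists_coherent_perm_of_sets α
  have key (D R : Set α) (g : α → α) : ∃ π : Equiv.Perm α, Set.BijOn g D R →
      ∀ x, π x = D.piecewise g (σ D R) x := by
    by_cases hg : Set.BijOn g D R
    · have hmem := hσ D R hg.ncard_eq
      have hinj : Function.Injective (D.piecewise g (σ D R)) := by
        rw [Set.injective_piecewise_iff]
        refine ⟨hg.injOn, (σ D R).injective.injOn, fun x hx y hy h => hy ?_⟩
        rw [← hmem, ← h]
        exact hg.mapsTo hx
      exact ⟨Equiv.ofBijective _ (Finite.injective_iff_bijective.mp hinj), fun _ _ => rfl⟩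
    · exact ⟨1, fun h => absurd h hg⟩
  choose E hE using key
  have hmem (D R : Set α) (g : α → α) (hg : Set.BijOn g D R) (x : α) :
      E D R g x ∈ R ↔ x ∈ D := by
    rw [hE D R g hg]
    by_cases hx : x ∈ D
    · simp [hx, hg.mapsTo hx]
    · simp [hx, hσ D R hg.ncard_eq]
  refine ⟨E, fun D R g hg => ⟨fun x hx => by simp [hE D R g hg, hx], hmem D R g hg⟩,
    fun D R T g h k hg hh hk x => ?_⟩
  have hkT : Set.BijOn k D T := (hh.comp hg).congr hk.symm
  rw [hE D T k hkT, hE R T h hh]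
  by_cases hx : x ∈ D
  · rw [Set.piecewise_eq_of_mem _ _ _ hx, hk hx,
      Set.piecewise_eq_of_mem _ _ _ ((hmem D R g hg x).2 hx), hE D R g hg,
      Set.piecewise_eq_of_mem _ _ _ hx, Function.comp_apply]
  · rw [Set.piecewise_eq_of_notMem _ _ _ hx,
      Set.piecewise_eq_of_notMem _ _ _ (mt (hmem D R g hg x).1 hx), hE D R g hg,
      Set.piecewise_eq_of_notMem _ _ _ hx, hcomp]

/-- The graph on pairs of a point and a valuation, where `(x, χ)` and `(y, ξ)` are adjacent
when `x ≠ y` and `χ y ≠ ξ x`. -/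
def valuationGraph (α : Type*) : SimpleGraph (α × (α → Bool)) where
  Adj a b := a.1 ≠ b.1 ∧ a.2 b.1 ≠ b.2 a.1
  symm := ⟨fun _ _ h => ⟨h.1.symm, h.2.symm⟩⟩
  loopless := ⟨fun _ h => h.1 rfl⟩

/-- Permute the points by `π` and flip the valuations along the symmetric relation `F`. -/
def valuationIso {α : Type*} (π : Equiv.Perm α) (F : α → α → Bool)
    (hF : ∀ x y, F x y = F y x) : valuationGraph α ≃g valuationGraph α where
  toFun a := (π a.1, fun y => xor (a.2 (π.symm y)) (F a.1 (π.symm y)))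
  invFun a := (π.symm a.1, fun y => xor (a.2 (π y)) (F (π.symm a.1) y))
  left_inv a := by ext <;> simp
  right_inv a := by ext <;> simp
  map_rel_iff' {a b} := by
    simp [valuationGraph, hF b.1 a.1]

section Flip

variable {α : Type*}

open Classical in
/-- The flips needed for `valuationIso` to send `(x, c x)` to `(π x, c (π x))` for `x ∈ D`. -/
noncomputable def valuationFlip (c : α → α → Bool) (D : Set α) (π : Equiv.Perm α) (x y : α) :
    Bool :=
  if x ∈ D then xor (c (π x) (π y)) (c x y)
  else if y ∈ D then xor (c (π y) (π x)) (c y x)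
  else false

theorem valuationFlip_comm {c : α → α → Bool} {D : Set α} {π : Equiv.Perm α}
    (h : ∀ x ∈ D, ∀ y ∈ D,
      xor (c (π x) (π y)) (c (π y) (π x)) = xor (c x y) (c y x)) (x y : α) :
    valuationFlip c D π x y = valuationFlip c D π y x := by
  unfold valuationFlip
  split_ifs with hx hy
  · have := h x hx y hy
    revert this
    cases c (π x) (π y) <;> cases c (π y) (π x) <;> cases c x y <;> cases c y x <;> simp
  all_goals rfl

theorem valuationFlip_comp (c : α → α → Bool) {D R : Set α} {π ρ τ : Equiv.Perm α}
    (hπ : ∀ x, π x ∈ R ↔ x ∈ D) (hτ : ∀ x, τ x = ρ (π x)) (x y : α) :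
    valuationFlip c D τ x y = xor (valuationFlip c D π x y) (valuationFlip c R ρ (π x) (π y)) := by
  unfold valuationFlip
  by_cases hx : x ∈ D
  · simp only [hx, (hπ x).2 hx, hτ, if_true]
    cases c (π x) (π y) <;> simp [Bool.xor_comm]
  by_cases hy : y ∈ D
  · simp only [hx, hy, mt (hπ x).1 hx, (hπ y).2 hy, hτ, if_true, if_false]
    cases c (π y) (π x) <;> simp [Bool.xor_comm]
  · simp [hx, hy, mt (hπ x).1 hx, mt (hπ y).1 hy]

end Flip

/-- Coherent extension for partial automorphisms of a set of pairs `(x, c x)`. -/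
theorem exists_coherent_valuationIso {α : Type*} [Finite α] (c : α → α → Bool)
    (S : Set (α × (α → Bool))) (hS : ∀ a ∈ S, a.2 = c a.1) :
    ∃ ext : GraphPartialAut (valuationGraph α) S → (valuationGraph α ≃g valuationGraph α),
      (∀ p, ∀ a ∈ p.dom, ext p a = p.f a) ∧
        ∀ p q r, GraphCoherentTriple p q r → ∀ a, ext r a = ext q (ext p a) := by
  obtain ⟨E, hE, hcomp⟩ := exists_coherent_perm_extension α
  let s (x : α) : α × (α → Bool) := (x, c x)
  have hs {a} (ha : a ∈ S) : s a.1 = a := Prod.ext rfl (hS a ha).symm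
  let D (p : GraphPartialAut (valuationGraph α) S) : Set α := s ⁻¹' p.dom
  let R (p : GraphPartialAut (valuationGraph α) S) : Set α := s ⁻¹' p.ran
  let g (p : GraphPartialAut (valuationGraph α) S) (x : α) : α := (p.f (s x)).1
  have hsg (p) {x} (hx : x ∈ D p) : s (g p x) = p.f (s x) :=
    hs (p.ran_subset (p.maps_mem _ hx))
  have hg (p) : Set.BijOn (g p) (D p) (R p) := by
    refine ⟨fun x hx => ?_, fun x hx y hy h => ?_, fun y hy => ?_⟩
    · change s (g p x) ∈ p.ran
      rw [hsg p hx]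
      exact p.maps_mem _ hx
    · refine congrArg Prod.fst (p.injOn _ hx _ hy ?_)
      rw [← hsg p hx, ← hsg p hy, h]
    · obtain ⟨a, ha, hay⟩ := p.surjOn _ hy
      have has := hs (p.dom_subset ha)
      refine ⟨a.1, ?_, ?_⟩
      · change s a.1 ∈ p.dom
        rwa [has]
      · change (p.f (s a.1)).1 = y
        rw [has, hay]
  let π (p : GraphPartialAut (valuationGraph α) S) : Equiv.Perm α := E (D p) (R p) (g p)
  have hπ (p) {x} (hx : x ∈ D p) : s (π p x) = p.f (s x) := by
    rw [← hsg p hx]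
    exact congrArg s ((hE _ _ _ (hg p)).1 hx)
  have hflip (p) := valuationFlip_comm (c := c) (D := D p) (π := π p) fun x hx y hy => by
    have h := p.adj_iff _ hx _ hy
    rw [← hπ p hx, ← hπ p hy] at h
    by_cases hxy : x = y
    · simp [hxy]
    · have h' : c (π p x) (π p y) = c (π p y) (π p x) ↔ c x y = c y x := by
        simpa [valuationGraph, s, hxy, not_iff_not] using h
      revert h'
      cases c (π p x) (π p y) <;> cases c (π p y) (π p x) <;> cases c x y <;>
        cases c y x <;> simp
  refine ⟨fun p => valuationIso (π p) (valuationFlip c (D p) (π p)) (hflip p), fun p a ha => ?_,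
    fun p q r ⟨h₁, h₂, h₃, h₄⟩ a => ?_⟩
  · have has := hs (p.dom_subset ha)
    have hx : a.1 ∈ D p := by
      change s a.1 ∈ p.dom
      rwa [has]
    rw [← has, ← hπ p hx]
    ext y
    · rfl
    · simp [valuationIso, s, valuationFlip, hx, Bool.xor_left_comm (c a.1 _)]
  · have hD : D r = D p := congrArg (s ⁻¹' ·) h₁.symm
    have hR : D q = R p := congrArg (s ⁻¹' ·) h₂.symm
    have hT : R r = R q := congrArg (s ⁻¹' ·) h₃.symm
    have hτ (x : α) : π r x = π q (π p x) := by
      simp only [π, hD, hR, hT]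
      refine hcomp _ _ _ _ _ _ (hg p) (hR ▸ hg q) (fun x hx => ?_) x
      change (r.f (s x)).1 = (q.f (s (g p x))).1
      rw [hsg p hx, h₄ _ hx]
    have hsymm (y : α) : (π r).symm y = (π p).symm ((π q).symm y) := by
      rw [Equiv.symm_apply_eq, hτ]
      simp
    have hF := valuationFlip_comp c (hE _ _ _ (hg p)).2 hτ
    ext y
    · exact hτ a.1
    · change xor (a.2 ((π r).symm y)) (valuationFlip c (D r) (π r) a.1 ((π r).symm y)) =
        xor (xor (a.2 ((π p).symm ((π q).symm y)))
          (valuationFlip c (D p) (π p) a.1 ((π p).symm ((π q).symm y))))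
          (valuationFlip c (D q) (π q) (π p a.1) ((π q).symm y))
      rw [hD, hR, hF, hsymm, Bool.xor_assoc]
      simp [π]

/-- **Coherent EPPA for the class of all finite graphs.** For every finite simple graph
`A` there is a finite simple graph `B`, a graph embedding `ψ : A → B` and a map `ext`
assigning to every partial automorphism of `ψ(A)` an automorphism of `B` extending it,
such that `ext` sends coherent triples to coherent triples. -/
theorem finite_graphs_coherent_eppa (V : Type u) [Fintype V] (A : SimpleGraph V) :
    ∃ (W : Type) (_ : Fintype W) (B : SimpleGraph W) (ψ : A ↪g B)
      (ext : GraphPartialAut B (Set.range ⇑ψ) → (B ≃g B)),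
      (∀ p, ∀ x ∈ p.dom, ext p x = p.f x) ∧
        ∀ p q r, GraphCoherentTriple p q r → ∀ x, ext r x = ext q (ext p x) := by
  classical
  let e := Fintype.equivFin V
  let c (i j : Fin (Fintype.card V)) : Bool := decide (j < i ∧ A.Adj (e.symm i) (e.symm j))
  let ψ : A ↪g valuationGraph (Fin (Fintype.card V)) :=
    { toFun v := (e v, c (e v))
      inj' v w h := e.injective (congrArg Prod.fst h)
      map_rel_iff' {v w} := by
        change (e v ≠ e w ∧ c (e v) (e w) ≠ c (e w) (e v)) ↔ A.Adj v w
        rcases lt_trichotomy (e v) (e w) with h | h | h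
        · simp [c, h, h.ne, h.not_gt, A.adj_comm w v]
        · simp [e.injective h]
        · simp [c, h, h.ne', h.not_gt] }
  obtain ⟨ext, hext⟩ := exists_coherent_valuationIso c (Set.range ψ) (by rintro _ ⟨v, rfl⟩; rfl)
  exact ⟨_, inferInstance, _, ψ, ext, hext⟩

end EPPA
end

section
/- For every finite set A there is a map assigning to each partial injection φ of A (a bijection between two subsets of A) a permutation θ_φ of A extending φ, such that for every coherent triple (φ₁, φ₂, φ) of partial injections of A (i.e. Dom(φ₁) = Dom(φ), Range(φ₁) = Dom(φ₂), Range(φ₂) = Range(φ), and φ = φ₂ ∘ φ₁) one has θ_φ = θ_{φ₂} ∘ θ_{φ₁}. In other words, the class of all finite sets has coherent EPPA. -/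
set_option autoImplicit false

universe u

namespace EPPA

/-- A partial injection of `α`: a bijection between two subsets of `α`, recorded as its
domain, its range and its underlying map. -/
structure PartialInj (α : Type u) where
  dom : Set α
  ran : Set α
  f : α → α
  maps_mem : ∀ x ∈ dom, f x ∈ ran
  injOn : ∀ x ∈ dom, ∀ y ∈ dom, f x = f y → x = y
  surjOn : ∀ y ∈ ran, ∃ x ∈ dom, f x = y

/-- The bijection from the domain to the range of a partial injection. -/
noncomputable def PartialInj.toEquiv {α : Type u} (p : PartialInj α) : p.dom ≃ p.ran :=
  Equiv.ofBijective (fun x => ⟨p.f x, p.maps_mem x x.2⟩)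
    ⟨fun x y h => Subtype.ext (p.injOn x x.2 y y.2 (congrArg Subtype.val h)),
      fun y => (p.surjOn y y.2).elim fun x hx => ⟨⟨x, hx.1⟩, Subtype.ext hx.2⟩⟩

/-- The bijection between two finite sets of the same size that matches up their chosen
enumerations. -/
noncomputable def enumEquiv {α : Type u} [Finite α] (s t : Set α)
    (h : Nat.card s = Nat.card t) : s ≃ t :=
  (Finite.equivFin s).trans ((finCongr h).trans (Finite.equivFin t).symm)

theorem enumEquiv_trans {α : Type u} [Finite α] {s t v : Set α}
    (h : Nat.card s = Nat.card t) (h' : Nat.card t = Nat.card v) (x : s) :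
    enumEquiv t v h' (enumEquiv s t h x) = enumEquiv s v (h.trans h') x := by
  simp only [enumEquiv, Equiv.trans_apply, Equiv.symm_apply_eq, Equiv.apply_symm_apply]
  rfl

theorem PartialInj.card_compl {α : Type u} [Finite α] (p : PartialInj α) :
    Nat.card ↥p.domᶜ = Nat.card ↥p.ranᶜ := by
  have h : p.dom.ncard = p.ran.ncard := Nat.card_congr p.toEquiv
  have hd := Set.ncard_add_ncard_compl p.dom
  have hr := Set.ncard_add_ncard_compl p.ran
  rw [Nat.card_coe_set_eq, Nat.card_coe_set_eq]
  omega

open Classical in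
/-- The extension of a partial injection of a finite type to a permutation which matches up
the enumerations of the complements of the domain and of the range. -/
noncomputable def PartialInj.extend {α : Type u} [Finite α] (p : PartialInj α) :
    Equiv.Perm α :=
  (Equiv.Set.sumCompl p.dom).symm.trans
    ((p.toEquiv.sumCongr (enumEquiv p.domᶜ p.ranᶜ p.card_compl)).trans
      (Equiv.Set.sumCompl p.ran))

open Classical in
theorem PartialInj.extend_of_mem {α : Type u} [Finite α] (p : PartialInj α) {x : α}
    (hx : x ∈ p.dom) : p.extend x = p.f x := by
  simp [extend, Equiv.Set.sumCompl_symm_apply_of_mem hx]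
  rfl

open Classical in
theorem PartialInj.extend_of_notMem {α : Type u} [Finite α] (p : PartialInj α) {x : α}
    (hx : x ∉ p.dom) : p.extend x = enumEquiv p.domᶜ p.ranᶜ p.card_compl ⟨x, hx⟩ := by
  simp [extend, Equiv.Set.sumCompl_symm_apply_of_notMem hx]

/-- **Coherent EPPA for the class of all finite sets.** For every finite set `α` there
is a map assigning to each partial injection `p` of `α` a permutation of `α` extending
it, such that coherent triples are sent to coherent triples. -/
theorem finite_sets_coherent_eppa (α : Type u) [Fintype α] :
    ∃ ext : PartialInj α → Equiv.Perm α,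
      (∀ p, ∀ x ∈ p.dom, ext p x = p.f x) ∧
        ∀ p q r : PartialInj α,
          p.dom = r.dom → p.ran = q.dom → q.ran = r.ran →
          (∀ x ∈ p.dom, r.f x = q.f (p.f x)) →
          ∀ x, ext r x = ext q (ext p x) := by
  refine ⟨PartialInj.extend, fun p x hx => p.extend_of_mem hx, fun p q r hd hm hr hf x => ?_⟩
  by_cases hx : x ∈ p.dom
  · rw [r.extend_of_mem (hd ▸ hx), p.extend_of_mem hx,
      q.extend_of_mem (hm ▸ p.maps_mem x hx), hf x hx]
  · have hy : (enumEquiv p.domᶜ p.ranᶜ p.card_compl ⟨x, hx⟩ : α) ∉ q.dom :=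
      hm ▸ Subtype.prop (enumEquiv p.domᶜ p.ranᶜ p.card_compl ⟨x, hx⟩)
    rw [r.extend_of_notMem (hd ▸ hx), p.extend_of_notMem hx, q.extend_of_notMem hy]
    obtain ⟨d, m, f, _, _, _⟩ := p
    obtain ⟨m', e, g, _, _, _⟩ := q
    obtain ⟨d', e', k, _, _, _⟩ := r
    dsimp only at hd hm hr hx
    subst hd hm hr
    exact congrArg Subtype.val (enumEquiv_trans _ _ _).symm

end EPPA
end

section
/- Let G be a finite connected simple graph containing no induced cycle of length at least 4. Then every inclusion-minimal vertex cut of G is a clique; that is, if S is a set of vertices such that deleting S disconnects G but deleting any proper subset of S does not, then any two distinct vertices of S are adjacent in G. -/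
set_option autoImplicit false

universe u

namespace EPPA

/-- `G` contains an induced cycle of length at least 4: there are `k ≥ 4` distinct
vertices `c 0, …, c (k-1)` which are adjacent exactly when cyclically consecutive. -/
def HasLongInducedCycle {V : Type u} (G : SimpleGraph V) : Prop :=
  ∃ k : ℕ, 4 ≤ k ∧ ∃ c : ZMod k → V, Function.Injective c ∧
    ∀ i j : ZMod k, G.Adj (c i) (c j) ↔ (j = i + 1 ∨ i = j + 1)

/-- `S` is a vertex cut of `G`: the induced subgraph on the complement of `S` is
disconnected. -/
def IsVertexCut {V : Type u} (G : SimpleGraph V) (S : Set V) : Prop :=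
  ¬(G.induce Sᶜ).Preconnected

/-- `f 0, …, f n` is an induced path of `G`: its vertices are distinct, and two of them are
adjacent exactly when they are consecutive. -/
structure IsInducedPath {V : Type u} (G : SimpleGraph V) (f : ℕ → V) (n : ℕ) : Prop where
  ne : ∀ i j, i < j → j ≤ n → f i ≠ f j
  adj_iff : ∀ i j, i < j → j ≤ n → (G.Adj (f i) (f j) ↔ j = i + 1)

/-- A shortest walk between two vertices is an induced path. -/
theorem exists_isInducedPath_of_reachable {V : Type u} {G : SimpleGraph V} {u v : V}
    (h : G.Reachable u v) :
    ∃ (n : ℕ) (f : ℕ → V), f 0 = u ∧ f n = v ∧ IsInducedPath G f n := by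
  obtain ⟨p, hp⟩ := h.exists_walk_length_eq_dist
  have hshort : ∀ i j, i < j → j ≤ p.length → ∀ q : G.Walk (p.getVert i) (p.getVert j),
      j ≤ i + q.length := by
    intro i j hij hj q
    have hle := SimpleGraph.dist_le (((p.take i).append q).append (p.drop j))
    simp only [SimpleGraph.Walk.length_append, SimpleGraph.Walk.take_length,
      SimpleGraph.Walk.drop_length] at hle
    omega
  refine ⟨p.length, p.getVert, p.getVert_zero, p.getVert_length, ?_, ?_⟩
  · intro i j hij hj heq
    have := hshort i j hij hj (SimpleGraph.Walk.nil.copy rfl heq)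
    simp at this
    omega
  · intro i j hij hj
    constructor
    · intro hadj
      have := hshort i j hij hj hadj.toWalk
      simp at this
      omega
    · rintro rfl
      exact p.adj_getVert_succ (by omega)

/-- Two vertices with neighbours in a connected set are joined by an induced path through it. -/
theorem exists_isInducedPath_through {V : Type u} {G : SimpleGraph V} {A : Set V}
    (hA : (G.induce A).Preconnected) {x y : V}
    (hx : ∃ p ∈ A, G.Adj x p) (hy : ∃ q ∈ A, G.Adj y q) :
    ∃ (n : ℕ) (f : ℕ → V), f 0 = x ∧ f n = y ∧ IsInducedPath G f n ∧
      ∀ i, 0 < i → i < n → f i ∈ A := by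
  obtain ⟨p, hpA, hxp⟩ := hx
  obtain ⟨q, hqA, hyq⟩ := hy
  have hsub : A ⊆ insert x (insert y A) := fun v hv => by simp [hv]
  have hpq := (hA ⟨p, hpA⟩ ⟨q, hqA⟩).map (SimpleGraph.induceHomOfLE G hsub).toHom
  have hxy : (G.induce (insert x (insert y A))).Reachable ⟨x, by simp⟩ ⟨y, by simp⟩ := by
    refine SimpleGraph.Reachable.trans ?_ (hpq.trans ?_)
    · exact SimpleGraph.Adj.reachable hxp
    · exact SimpleGraph.Adj.reachable hyq.symm
  obtain ⟨n, f, h0, hn, hf⟩ := exists_isInducedPath_of_reachable hxy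
  refine ⟨n, fun i => (f i : V), by simp [h0], by simp [hn], ⟨?_, ?_⟩, ?_⟩
  · intro i j hij hj heq
    exact hf.ne i j hij hj (Subtype.ext heq)
  · intro i j hij hj
    exact hf.adj_iff i j hij hj
  · intro i hi hin
    rcases (f i).2 with h | h | h
    · exact absurd (h0.trans (Subtype.ext h.symm)) (hf.ne 0 i hi hin.le)
    · exact absurd ((Subtype.ext h).trans hn.symm) (hf.ne i n hin le_rfl)
    · exact h

/-- An induced cycle given by a sequence of vertices indexed by natural numbers. -/
theorem hasLongInducedCycle_of_seq {V : Type u} {G : SimpleGraph V} {k : ℕ} (hk : 4 ≤ k)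
    (F : ℕ → V) (hne : ∀ i j, i < j → j < k → F i ≠ F j)
    (hadj : ∀ i j, i < j → j < k → (G.Adj (F i) (F j) ↔ j = i + 1 ∨ (i = 0 ∧ j + 1 = k))) :
    HasLongInducedCycle G := by
  have : NeZero k := ⟨by omega⟩
  have : Fact (1 < k) := ⟨by omega⟩
  have hsucc : ∀ i j : ZMod k, j = i + 1 ↔
      (j.val = i.val + 1 ∨ (i.val + 1 = k ∧ j.val = 0)) := by
    intro i j
    have hi := i.val_lt
    have hj := j.val_lt
    rw [← (ZMod.val_injective k).eq_iff, ZMod.val_add, ZMod.val_one]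
    rcases Nat.lt_or_ge (i.val + 1) k with h | h
    · rw [Nat.mod_eq_of_lt h]
      omega
    · have hik : i.val + 1 = k := by omega
      rw [hik, Nat.mod_self]
      omega
  refine ⟨k, hk, fun i => F i.val, ?_, ?_⟩
  · intro i j hij
    apply ZMod.val_injective k
    rcases lt_trichotomy i.val j.val with h | h | h
    · exact absurd hij (hne _ _ h j.val_lt)
    · exact h
    · exact absurd hij.symm (hne _ _ h i.val_lt)
  · intro i j
    have hi := i.val_lt
    have hj := j.val_lt
    rw [hsucc, hsucc]
    rcases lt_trichotomy i.val j.val with h | h | h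
    · rw [hadj _ _ h hj]
      omega
    · simp only [h, SimpleGraph.irrefl, false_iff]
      omega
    · rw [G.adj_comm, hadj _ _ h hi]
      omega

/-- Two induced paths with the same nonadjacent ends, whose interiors lie in disjoint sets with no
edges between them, form a long induced cycle. -/
theorem hasLongInducedCycle_of_paths {V : Type u} {G : SimpleGraph V} {A B : Set V}
    (hAB : ∀ u ∈ A, ∀ v ∈ B, u ≠ v ∧ ¬G.Adj u v) {x y : V} (hxy : x ≠ y) (hnadj : ¬G.Adj x y)
    {n m : ℕ} {f g : ℕ → V} (hf0 : f 0 = x) (hfn : f n = y) (hf : IsInducedPath G f n)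
    (hfA : ∀ i, 0 < i → i < n → f i ∈ A) (hg0 : g 0 = x) (hgm : g m = y)
    (hg : IsInducedPath G g m) (hgB : ∀ i, 0 < i → i < m → g i ∈ B) :
    HasLongInducedCycle G := by
  have two_le : ∀ (l : ℕ) (e : ℕ → V), e 0 = x → e l = y → IsInducedPath G e l → 2 ≤ l := by
    intro l e h0 hl he
    by_contra! hlt
    have : l = 0 ∨ l = 1 := by omega
    rcases this with rfl | rfl
    · exact hxy (h0.symm.trans hl)
    · exact hnadj (h0 ▸ hl ▸ (he.adj_iff 0 1 one_pos le_rfl).2 rfl)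
  have hn := two_le n f hf0 hfn hf
  have hm := two_le m g hg0 hgm hg
  refine hasLongInducedCycle_of_seq (k := n + m) (by omega)
    (fun i => if i ≤ n then f i else g (n + m - i)) ?_ ?_
  all_goals
    intro i j hij hj
    by_cases hjn : j ≤ n
    · simp only [hjn, hij.le.trans hjn, if_true]
      first
      | exact hf.ne i j hij hjn
      | rw [hf.adj_iff i j hij hjn]
        omega
    have hgj := hgB (n + m - j) (by omega) (by omega)
    by_cases hin : i ≤ n
    · simp only [hjn, hin, if_true, if_false]
      rcases Nat.eq_zero_or_pos i with rfl | hi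
      · rw [hf0, ← hg0]
        first
        | exact hg.ne _ _ (by omega) (by omega)
        | rw [hg.adj_iff _ _ (by omega) (by omega)]
          omega
      rcases hin.eq_or_lt with rfl | hin
      · rw [hfn, ← hgm]
        first
        | exact (hg.ne _ _ (by omega) (by omega)).symm
        | rw [G.adj_comm, hg.adj_iff _ _ (by omega) (by omega)]
          omega
      have := hAB _ (hfA i hi hin) _ hgj
      first
      | exact this.1
      | simp only [this.2, false_iff]
        omega
    · simp only [hjn, hin, if_false]
      first
      | exact (hg.ne _ _ (by omega) (by omega)).symm
      | rw [G.adj_comm, hg.adj_iff _ _ (by omega) (by omega)]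
        omega

/-- The vertices outside `S` that are joined to `a` by a walk avoiding `S`. -/
def componentAvoiding {V : Type u} (G : SimpleGraph V) (S : Set V) (a : ↥Sᶜ) : Set V :=
  Subtype.val '' {v | (G.induce Sᶜ).Reachable a v}

theorem componentAvoiding_preconnected {V : Type u} (G : SimpleGraph V) (S : Set V) (a : ↥Sᶜ) :
    (G.induce (componentAvoiding G S a)).Preconnected := by
  have key : ∀ v (h : (G.induce Sᶜ).Reachable a v),
      (G.induce (componentAvoiding G S a)).Reachable
        ⟨a, a, SimpleGraph.Reachable.refl a, rfl⟩ ⟨v, v, h, rfl⟩ := by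
    intro v h
    have h' := (SimpleGraph.reachable_iff_reflTransGen _ _).1 h
    induction h' with
    | refl => exact SimpleGraph.Reachable.refl _
    | @tail b c hab hbc ih =>
      have hb := (SimpleGraph.reachable_iff_reflTransGen _ _).2 hab
      exact (ih hb).trans (SimpleGraph.Adj.reachable hbc)
  rintro ⟨_, u, hu, rfl⟩ ⟨_, v, hv, rfl⟩
  exact (key u hu).symm.trans (key v hv)

theorem mem_componentAvoiding_of_adj {V : Type u} {G : SimpleGraph V} {S : Set V} {a : ↥Sᶜ}
    {u v : V} (hu : u ∈ componentAvoiding G S a) (hv : v ∉ S) (huv : G.Adj u v) :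
    v ∈ componentAvoiding G S a := by
  obtain ⟨w, hw, rfl⟩ := hu
  exact ⟨⟨v, hv⟩, SimpleGraph.Reachable.trans hw (SimpleGraph.Adj.reachable huv), rfl⟩

/-- Each vertex of a minimal vertex cut has a neighbour in every component it cuts off. -/
theorem exists_adj_componentAvoiding {V : Type u} {G : SimpleGraph V} {S : Set V}
    (hmin : ∀ T : Set V, T ⊂ S → ¬IsVertexCut G T) {a b : ↥Sᶜ}
    (hab : ¬(G.induce Sᶜ).Reachable a b) {s : V} (hs : s ∈ S) :
    ∃ p ∈ componentAvoiding G S a, G.Adj s p := by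
  by_contra! hno
  have hpre := not_not.1 (hmin (S \ {s}) (Set.sdiff_singleton_ssubset.2 hs))
  have hle : Sᶜ ⊆ (S \ {s})ᶜ := Set.compl_subset_compl.2 Set.sdiff_subset
  have hreach := hpre ⟨a, hle a.2⟩ ⟨b, hle b.2⟩
  have hclosed : ∀ v, Relation.ReflTransGen (G.induce (S \ {s})ᶜ).Adj ⟨a, hle a.2⟩ v →
      (v : V) ∈ componentAvoiding G S a := by
    intro v hv
    induction hv with
    | refl => exact ⟨a, SimpleGraph.Reachable.refl a, rfl⟩
    | @tail u w _ huw ih =>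
      have huw' : G.Adj u w := huw
      refine mem_componentAvoiding_of_adj ih (fun hwS => w.2 ⟨hwS, fun hws => ?_⟩) huw'
      have hw : (w : V) = s := hws
      rw [hw] at huw'
      exact hno u ih huw'.symm
  obtain ⟨c, hc, hcb⟩ := hclosed _ ((SimpleGraph.reachable_iff_reflTransGen _ _).1 hreach)
  exact hab (Subtype.ext hcb ▸ hc)

/-- **Minimal vertex cuts in chordal-like graphs are cliques.** In a finite connected
graph with no induced cycle of length at least 4, every inclusion-minimal vertex cut
is a clique. -/
theorem minimal_cut_isClique {V : Type u} [Fintype V] (G : SimpleGraph V)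
    (hconn : G.Connected) (hchordal : ¬HasLongInducedCycle G)
    (S : Set V) (hcut : IsVertexCut G S)
    (hmin : ∀ T : Set V, T ⊂ S → ¬IsVertexCut G T) :
    ∀ x ∈ S, ∀ y ∈ S, x ≠ y → G.Adj x y := by
  intro x hx y hy hxy
  by_contra hnadj
  simp only [IsVertexCut, SimpleGraph.Preconnected, not_forall] at hcut
  obtain ⟨a, b, hab⟩ := hcut
  have hba : ¬(G.induce Sᶜ).Reachable b a := fun h => hab h.symm
  obtain ⟨n, f, hf0, hfn, hf, hfA⟩ :=
    exists_isInducedPath_through (componentAvoiding_preconnected G S a)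
      (exists_adj_componentAvoiding hmin hab hx) (exists_adj_componentAvoiding hmin hab hy)
  obtain ⟨m, g, hg0, hgm, hg, hgB⟩ :=
    exists_isInducedPath_through (componentAvoiding_preconnected G S b)
      (exists_adj_componentAvoiding hmin hba hx) (exists_adj_componentAvoiding hmin hba hy)
  have hdisj : ∀ u ∈ componentAvoiding G S a, u ∉ componentAvoiding G S b := by
    rintro _ ⟨u, hu, rfl⟩ ⟨v, hv, hvu⟩
    obtain rfl := Subtype.ext hvu
    exact hab (SimpleGraph.Reachable.trans hu (SimpleGraph.Reachable.symm hv))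
  refine hchordal (hasLongInducedCycle_of_paths (fun u hu v hv => ⟨?_, fun huv => ?_⟩) hxy hnadj
    hf0 hfn hf hfA hg0 hgm hg hgB)
  · rintro rfl
    exact hdisj u hu hv
  · have hvS : v ∉ S := by
      obtain ⟨w, -, rfl⟩ := hv
      exact w.2
    exact hdisj v (mem_componentAvoiding_of_adj hu hvS huv) hv

end EPPA
end

section
/- Fix n ≥ 2 and let M_n denote the class of all finite metric spaces with integer distances that contain no n points pairwise at distance 1. For every A ∈ M_n there exists B ∈ M_n and an isometric embedding ψ : A → B such that every partial isometry of ψ(A) (a distance-preserving bijection between two subsets of ψ(A)) extends to a self-isometry of B; moreover the extension can be chosen coherently, i.e. via a map φ ↦ φ̂ into the isometry group of B sending coherent triples of partial isometries to coherent triples. In other words, M_n has coherent EPPA for every n ≥ 2. -/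
set_option autoImplicit false

universe u

namespace EPPA

/-- An integer-valued metric on `X`. -/
structure IntMetric (X : Type u) where
  d : X → X → ℤ
  d_eq_zero_iff : ∀ x y, d x y = 0 ↔ x = y
  d_symm : ∀ x y, d x y = d y x
  d_triangle : ∀ x y z, d x z ≤ d x y + d y z

/-- The metric space `(X, m)` contains a copy of `K_n`: `n` points pairwise at
distance `1`. -/
def ContainsKn {X : Type u} (m : IntMetric X) (n : ℕ) : Prop :=
  ∃ p : Fin n → X, Function.Injective p ∧ ∀ i j, i ≠ j → m.d (p i) (p j) = 1

/-- A partial isometry of `(X, m)`: a distance-preserving bijection between two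
subsets of `X`. -/
structure PartialIsometry {X : Type u} (m : IntMetric X) where
  dom : Set X
  ran : Set X
  f : X → X
  maps_mem : ∀ x ∈ dom, f x ∈ ran
  injOn : ∀ x ∈ dom, ∀ y ∈ dom, f x = f y → x = y
  surjOn : ∀ y ∈ ran, ∃ x ∈ dom, f x = y
  dist_eq : ∀ x ∈ dom, ∀ y ∈ dom, m.d (f x) (f y) = m.d x y

section ExtendPerm

variable {α : Type*}

/-- An enumeration of the complement of `X` by natural numbers, chosen once for each set `X`. -/
noncomputable def complIndex [Finite α] (X : Set α) (a : α) : ℕ :=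
  open Classical in if h : a ∉ X then (Finite.equivFin {a // a ∉ X} ⟨a, h⟩ : ℕ) else 0

theorem complIndex_inj [Finite α] {X : Set α} {a b : α} (ha : a ∉ X) (hb : b ∉ X)
    (h : complIndex X a = complIndex X b) : a = b := by
  simp only [complIndex, dif_pos ha, dif_pos hb] at h
  simpa using (Finite.equivFin {a // a ∉ X}).injective (Fin.ext h)

/-- The domain of a relation. -/
def relDom (r : α → α → Prop) : Set α := {a | ∃ b, r a b}

/-- The range of a relation. -/
def relRan (r : α → α → Prop) : Set α := {b | ∃ a, r a b}

theorem exists_extendPerm [Finite α] {r : α → α → Prop} (hr : Relator.BiUnique r) :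
    ∃ e : Equiv.Perm α, (∀ a b, r a b → e a = b) ∧
      ∀ a ∉ relDom r, e a ∉ relRan r ∧ complIndex (relRan r) (e a) = complIndex (relDom r) a := by
  classical
  let e₁ : {a // a ∈ relDom r} ≃ {b // b ∈ relRan r} :=
    { toFun := fun a => ⟨a.2.choose, a.1, a.2.choose_spec⟩
      invFun := fun b => ⟨b.2.choose, b.1, b.2.choose_spec⟩
      left_inv := fun a => Subtype.ext <| hr.1
        (Exists.choose_spec (⟨a.1, a.2.choose_spec⟩ : ∃ x, r x a.2.choose)) a.2.choose_spec
      right_inv := fun b => Subtype.ext <| hr.2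
        (Exists.choose_spec (⟨b.1, b.2.choose_spec⟩ : ∃ x, r b.2.choose x)) b.2.choose_spec }
  have hcard : Nat.card {a // a ∉ relDom r} = Nat.card {b // b ∉ relRan r} := by
    have h₁ := Set.ncard_add_ncard_compl (relDom r)
    have h₂ := Set.ncard_add_ncard_compl (relRan r)
    have h₃ : (relDom r).ncard = (relRan r).ncard := Nat.card_congr e₁
    have h₄ : (relDom r)ᶜ.ncard = (relRan r)ᶜ.ncard := by omega
    exact h₄
  let e₂ : {a // a ∉ relDom r} ≃ {b // b ∉ relRan r} :=
    ((Finite.equivFin _).trans (finCongr hcard)).trans (Finite.equivFin _).symm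
  refine ⟨Equiv.subtypeCongr e₁ e₂, fun a b hab => ?_, fun a ha => ?_⟩
  · have ha : a ∈ relDom r := ⟨b, hab⟩
    have : Equiv.subtypeCongr e₁ e₂ a = e₁ ⟨a, ha⟩ := by
      simp [Equiv.subtypeCongr, Equiv.sumCompl_symm_apply_of_pos ha]
    rw [this]
    exact hr.2 ha.choose_spec hab
  · have : Equiv.subtypeCongr e₁ e₂ a = e₂ ⟨a, ha⟩ := by
      simp [Equiv.subtypeCongr, Equiv.sumCompl_symm_apply_of_neg ha]
    rw [this]
    refine ⟨(e₂ ⟨a, ha⟩).2, ?_⟩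
    simp only [complIndex, dif_pos ha, dif_pos (e₂ ⟨a, ha⟩).2]
    simp [e₂]

open Classical in
/-- The coherent extension of a partial bijection of a finite set to a permutation. -/
noncomputable def extendPerm [Finite α] (r : α → α → Prop) : Equiv.Perm α :=
  if hr : Relator.BiUnique r then (exists_extendPerm hr).choose else 1

theorem extendPerm_apply [Finite α] {r : α → α → Prop} (hr : Relator.BiUnique r) {a b : α}
    (hab : r a b) : extendPerm r a = b := by
  rw [extendPerm, dif_pos hr]
  exact (exists_extendPerm hr).choose_spec.1 a b hab

theorem extendPerm_of_notMem [Finite α] {r : α → α → Prop} (hr : Relator.BiUnique r) {a : α}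
    (ha : a ∉ relDom r) : extendPerm r a ∉ relRan r ∧
      complIndex (relRan r) (extendPerm r a) = complIndex (relDom r) a := by
  rw [extendPerm, dif_pos hr]
  exact (exists_extendPerm hr).choose_spec.2 a ha

theorem extendPerm_comp [Finite α] {r s t : α → α → Prop} (hr : Relator.BiUnique r)
    (hs : Relator.BiUnique s) (ht : Relator.BiUnique t) (hrs : relRan r = relDom s)
    (htd : relDom t = relDom r) (htr : relRan t = relRan s)
    (h : ∀ a b c, r a b → s b c → t a c) (a : α) :
    extendPerm t a = extendPerm s (extendPerm r a) := by
  by_cases ha : a ∈ relDom r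
  · obtain ⟨b, hab⟩ := ha
    obtain ⟨c, hbc⟩ : b ∈ relDom s := hrs ▸ ⟨a, hab⟩
    rw [extendPerm_apply hr hab, extendPerm_apply hs hbc, extendPerm_apply ht (h a b c hab hbc)]
  · obtain ⟨h₁, h₂⟩ := extendPerm_of_notMem hr ha
    obtain ⟨h₃, h₄⟩ := extendPerm_of_notMem hs (hrs ▸ h₁)
    obtain ⟨h₅, h₆⟩ := extendPerm_of_notMem ht (htd ▸ ha)
    rw [htr] at h₅ h₆
    refine complIndex_inj h₅ h₃ ?_
    rw [h₆, h₄, ← hrs, h₂, htd]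

end ExtendPerm

section Walk

/-- `Walk E x y w`: some walk from `x` to `y` along the labelled edges `E` has total weight `w`. -/
inductive Walk {V : Type u} (E : V → V → ℕ → Prop) : V → V → ℕ → Prop
  | nil (x : V) : Walk E x x 0
  | cons {x y z : V} {d w : ℕ} : E x y d → Walk E y z w → Walk E x z (d + w)

variable {V V' : Type u} {E : V → V → ℕ → Prop} {E' : V' → V' → ℕ → Prop}

theorem Walk.append {x y z : V} {s t : ℕ} (h : Walk E x y s) (h' : Walk E y z t) :
    Walk E x z (s + t) := by
  induction h with
  | nil => simpa using h'
  | cons he _ ih => rw [add_assoc]; exact .cons he (ih h')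

theorem Walk.single {x y : V} {d : ℕ} (h : E x y d) : Walk E x y d := .cons h (.nil y)

theorem Walk.map {f : V → V'} (hf : ∀ x y d, E x y d → E' (f x) (f y) d) {x y : V} {w : ℕ}
    (h : Walk E x y w) : Walk E' (f x) (f y) w := by
  induction h with
  | nil => exact .nil _
  | cons he _ ih => exact .cons (hf _ _ _ he) ih

theorem Walk.symm (hE : ∀ x y d, E x y d → E y x d) {x y : V} {w : ℕ}
    (h : Walk E x y w) : Walk E y x w := by
  induction h with
  | nil => exact .nil _
  | cons he _ ih => rw [add_comm]; exact ih.append (.single (hE _ _ _ he))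

theorem Walk.eq_of_zero (hE : ∀ x y d, E x y d → 0 < d) {x y : V} (h : Walk E x y 0) :
    x = y := by
  generalize hw : 0 = w at h
  cases h with
  | nil => rfl
  | cons he _ => have := hE _ _ _ he; omega

theorem Walk.edge_of_one (hE : ∀ x y d, E x y d → 0 < d) {x y : V} (h : Walk E x y 1) :
    E x y 1 := by
  generalize hw : 1 = w at h
  cases h with
  | nil => omega
  | @cons _ _ _ d w he h =>
    have hd := hE _ _ _ he
    obtain rfl : w = 0 := by omega
    obtain rfl := h.eq_of_zero hE
    obtain rfl : d = 1 := by omega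
    exact he

theorem Walk.equiv_iff (e : Equiv.Perm V) (he : ∀ x y d, E (e x) (e y) d ↔ E x y d) (x y : V)
    (w : ℕ) : Walk E (e x) (e y) w ↔ Walk E x y w := by
  refine ⟨fun h => ?_, fun h => h.map fun x y d => (he x y d).2⟩
  simpa using h.map (f := e.symm) fun x y d h => (he _ _ _).1 (by simpa using h)

/-- The labelled graph `E` has no non-metric closed walk whose short part weighs less than `w`. -/
def MetricBelow (E : V → V → ℕ → Prop) (w : ℕ) : Prop :=
  ∀ x y s d, s < w → Walk E x y s → E x y d → d ≤ s

/-- The path metric of a labelled graph, truncated at `D`. -/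
noncomputable def walkDist (E : V → V → ℕ → Prop) (D : ℕ) (x y : V) : ℕ :=
  sInf {w | Walk E x y w ∨ D ≤ w}

theorem walkDist_spec (D : ℕ) (x y : V) :
    Walk E x y (walkDist E D x y) ∨ D ≤ walkDist E D x y :=
  Nat.sInf_mem (s := {w | Walk E x y w ∨ D ≤ w}) ⟨D, .inr le_rfl⟩

theorem walkDist_le {D w : ℕ} {x y : V} (h : Walk E x y w ∨ D ≤ w) : walkDist E D x y ≤ w :=
  Nat.sInf_le h

/-- The path metric of a labelled graph, truncated at `D`, as an integer metric. -/
noncomputable def walkMetric {D : ℕ} (hD : 0 < D) (hpos : ∀ x y d, E x y d → 0 < d)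
    (hsymm : ∀ x y d, E x y d → E y x d) : IntMetric V where
  d x y := walkDist E D x y
  d_eq_zero_iff x y := by
    rw [Nat.cast_eq_zero]
    constructor
    · intro h
      have := walkDist_spec (E := E) D x y
      rw [h] at this
      exact (this.resolve_right (by omega)).eq_of_zero hpos
    · rintro rfl
      exact Nat.le_zero.1 (walkDist_le (.inl (.nil x)))
  d_symm x y := by
    have : ∀ w, Walk E x y w ↔ Walk E y x w := fun w => ⟨Walk.symm hsymm, Walk.symm hsymm⟩
    simp only [walkDist, this]
  d_triangle x y z := by
    rw [← Nat.cast_add, Nat.cast_le]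
    apply walkDist_le
    rcases walkDist_spec (E := E) D x y with h | h
    · rcases walkDist_spec (E := E) D y z with h' | h'
      · exact .inl (h.append h')
      · right; omega
    · right; omega

end Walk

section Coherent

variable {A : Type u} {m : IntMetric A}

namespace IntMetric

theorem d_nonneg (m : IntMetric A) (x y : A) : 0 ≤ m.d x y := by
  have h₁ := m.d_triangle x y x
  rw [(m.d_eq_zero_iff x x).2 rfl, m.d_symm y x] at h₁
  omega

/-- The distance as a natural number. -/
def natDist (m : IntMetric A) (x y : A) : ℕ := (m.d x y).toNat

theorem natDist_cast (m : IntMetric A) (x y : A) : (m.natDist x y : ℤ) = m.d x y :=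
  Int.toNat_of_nonneg (m.d_nonneg x y)

theorem natDist_triangle (m : IntMetric A) (x y z : A) :
    m.natDist x z ≤ m.natDist x y + m.natDist y z := by
  have := m.d_triangle x y z
  simp only [← natDist_cast] at this
  exact_mod_cast this

theorem natDist_symm (m : IntMetric A) (x y : A) : m.natDist x y = m.natDist y x := by
  rw [natDist, natDist, m.d_symm]

theorem natDist_pos (m : IntMetric A) {x y : A} (h : x ≠ y) : 0 < m.natDist x y := by
  have h₁ := mt (m.d_eq_zero_iff x y).1 h
  rw [← natDist_cast] at h₁
  omega

end IntMetric

/-- The triple `(p, q, r)` of partial isometries is coherent: `r = q ∘ p`. -/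
structure IsCoherent (p q r : PartialIsometry m) : Prop where
  dom_eq : p.dom = r.dom
  ran_eq_dom : p.ran = q.dom
  ran_eq : q.ran = r.ran
  comp : ∀ x ∈ p.dom, r.f x = q.f (p.f x)

theorem PartialIsometry.natDist_eq (p : PartialIsometry m) {x y : A} (hx : x ∈ p.dom)
    (hy : y ∈ p.dom) : m.natDist (p.f x) (p.f y) = m.natDist x y := by
  rw [IntMetric.natDist, p.dist_eq x hx y hy, IntMetric.natDist]

/-- A finite graph with edges labelled by `1, …, D`, with a homomorphism from the metric space
`(A, m)` and a coherent extension of the partial isometries of `A` to automorphisms. -/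
structure Witness (m : IntMetric A) (D : ℕ) where
  V : Type u
  finite : Finite V
  E : V → V → ℕ → Prop
  symm : ∀ x y d, E x y d → E y x d
  irrefl : ∀ x d, ¬E x x d
  pos : ∀ x y d, E x y d → 0 < d
  le : ∀ x y d, E x y d → d ≤ D
  ψ : A → V
  hom : ∀ x y, x ≠ y → E (ψ x) (ψ y) (m.natDist x y)
  T : PartialIsometry m → Equiv.Perm V
  aut : ∀ p x y d, E (T p x) (T p y) d ↔ E x y d
  extends_f : ∀ p : PartialIsometry m, ∀ x ∈ p.dom, T p (ψ x) = ψ (p.f x)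
  coherent : ∀ p q r, IsCoherent p q r → ∀ x, T r x = T q (T p x)

namespace Witness

variable {D : ℕ}

theorem ψ_injective (𝒲 : Witness m D) : Function.Injective 𝒲.ψ := by
  intro x y h
  by_contra hne
  have := 𝒲.hom x y hne
  rw [h] at this
  exact 𝒲.irrefl _ _ this

/-- The complete multigraph on `A`, on which partial isometries act by extending them to arbitrary
permutations. -/
theorem exists_initial [Finite A] (hD : ∀ x y, m.natDist x y ≤ D) :
    ∃ 𝒲 : Witness m D, MetricBelow 𝒲.E 1 := by
  let r : PartialIsometry m → A → A → Prop := fun p x y => x ∈ p.dom ∧ p.f x = y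
  have hr : ∀ p, Relator.BiUnique (r p) := fun p =>
    ⟨fun x y z hx hy => p.injOn x hx.1 y hy.1 (hx.2.trans hy.2.symm),
      fun x y z hy hz => hy.2.symm.trans hz.2⟩
  have hdom : ∀ p, relDom (r p) = p.dom := fun p => Set.ext fun x =>
    ⟨fun ⟨_, h⟩ => h.1, fun h => ⟨_, h, rfl⟩⟩
  have hran : ∀ p, relRan (r p) = p.ran := fun p => Set.ext fun y =>
    ⟨fun ⟨x, h⟩ => h.2 ▸ p.maps_mem x h.1, fun h => p.surjOn y h⟩
  refine ⟨{ V := A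
            finite := inferInstance
            E := fun x y d => x ≠ y ∧ 0 < d ∧ d ≤ D
            symm := fun x y d h => ⟨h.1.symm, h.2⟩
            irrefl := fun x d h => h.1 rfl
            pos := fun x y d h => h.2.1
            le := fun x y d h => h.2.2
            ψ := id
            hom := fun x y h => ⟨h, m.natDist_pos h, hD x y⟩
            T := fun p => extendPerm (r p)
            aut := fun p x y d => by simp
            extends_f := fun p x hx => extendPerm_apply (hr p) ⟨hx, rfl⟩
            coherent := fun p q t h => extendPerm_comp (hr p) (hr q) (hr t) ?_ ?_ ?_ ?_ }, ?_⟩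
  · rw [hran, hdom, h.ran_eq_dom]
  · rw [hdom, hdom, h.dom_eq]
  · rw [hran, hran, h.ran_eq]
  · rintro a b c ⟨ha, rfl⟩ ⟨-, rfl⟩
    exact ⟨h.dom_eq ▸ ha, h.comp a ha⟩
  · intro x y s d hs hw he
    obtain rfl : s = 0 := by omega
    exact absurd (hw.eq_of_zero fun x y d h => h.2.1) he.1

/-- Index set, with an action of the partial isometries, of constraints on the vertices of a
witness: the valuations in `K` of two adjacent vertices incident with `i` should be equal exactly
if `R i` holds. -/
structure Constraint (𝒲 : Witness m D) (I K : Type u) where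
  S : PartialIsometry m → Equiv.Perm I
  coherent : ∀ p q r, IsCoherent p q r → ∀ i, S r i = S q (S p i)
  mem : 𝒲.V → I → Prop
  mem_iff : ∀ p x i, mem (𝒲.T p x) (S p i) ↔ mem x i
  R : I → 𝒲.V → 𝒲.V → ℕ → Prop
  R_symm : ∀ i x y d, R i x y d → R i y x d
  R_iff : ∀ p i x y d, R (S p i) (𝒲.T p x) (𝒲.T p y) d ↔ R i x y d
  g : I → A → K
  g_eq_iff : ∀ i x y, x ≠ y → mem (𝒲.ψ x) i → mem (𝒲.ψ y) i →
    (g i x = g i y ↔ R i (𝒲.ψ x) (𝒲.ψ y) (m.natDist x y))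

namespace Constraint

variable {𝒲 : Witness m D} {I K : Type u} (c : Constraint 𝒲 I K)

/-- The partial bijection of `K` induced by a partial isometry at the index `i`. -/
def rel (p : PartialIsometry m) (i : I) (a b : K) : Prop :=
  ∃ x ∈ p.dom, c.mem (𝒲.ψ x) i ∧ c.g i x = a ∧ c.g (c.S p i) (p.f x) = b

theorem mem_map {p : PartialIsometry m} {x : A} (hx : x ∈ p.dom) (i : I) :
    c.mem (𝒲.ψ (p.f x)) (c.S p i) ↔ c.mem (𝒲.ψ x) i := by
  rw [← 𝒲.extends_f p x hx, c.mem_iff]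

theorem g_map_eq_iff {p : PartialIsometry m} {x y : A} {i : I} (hx : x ∈ p.dom) (hy : y ∈ p.dom)
    (hxi : c.mem (𝒲.ψ x) i) (hyi : c.mem (𝒲.ψ y) i) :
    c.g (c.S p i) (p.f x) = c.g (c.S p i) (p.f y) ↔ c.g i x = c.g i y := by
  by_cases hxy : x = y
  · simp [hxy]
  rw [c.g_eq_iff i x y hxy hxi hyi, c.g_eq_iff _ _ _ (fun h => hxy (p.injOn x hx y hy h))
    ((c.mem_map hx i).2 hxi) ((c.mem_map hy i).2 hyi), ← 𝒲.extends_f p x hx,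
    ← 𝒲.extends_f p y hy, c.R_iff, p.natDist_eq hx hy]

theorem rel_biUnique (p : PartialIsometry m) (i : I) : Relator.BiUnique (c.rel p i) := by
  constructor
  · rintro _ _ _ ⟨x, hx, hxi, rfl, h⟩ ⟨y, hy, hyi, rfl, rfl⟩
    exact (c.g_map_eq_iff hx hy hxi hyi).1 h
  · rintro _ _ _ ⟨x, hx, hxi, rfl, rfl⟩ ⟨y, hy, hyi, h, rfl⟩
    exact ((c.g_map_eq_iff hy hx hyi hxi).2 h).symm

theorem relDom_rel (p : PartialIsometry m) (i : I) :
    relDom (c.rel p i) = {a | ∃ x ∈ p.dom, c.mem (𝒲.ψ x) i ∧ c.g i x = a} :=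
  Set.ext fun _ => ⟨fun ⟨_, x, hx, hxi, h, _⟩ => ⟨x, hx, hxi, h⟩,
    fun ⟨x, hx, hxi, h⟩ => ⟨_, x, hx, hxi, h, rfl⟩⟩

theorem relRan_rel (p : PartialIsometry m) (i : I) :
    relRan (c.rel p i) =
      {b | ∃ y ∈ p.ran, c.mem (𝒲.ψ y) (c.S p i) ∧ c.g (c.S p i) y = b} := by
  ext b
  constructor
  · rintro ⟨_, x, hx, hxi, -, rfl⟩
    exact ⟨_, p.maps_mem x hx, (c.mem_map hx i).2 hxi, rfl⟩
  · rintro ⟨y, hy, hyi, rfl⟩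
    obtain ⟨x, hx, rfl⟩ := p.surjOn y hy
    exact ⟨_, x, hx, (c.mem_map hx i).1 hyi, rfl, rfl⟩

theorem extendPerm_rel_comp [Finite K] {p q r : PartialIsometry m} (h : IsCoherent p q r) (i : I)
    (a : K) : extendPerm (c.rel r i) a =
      extendPerm (c.rel q (c.S p i)) (extendPerm (c.rel p i) a) := by
  refine extendPerm_comp (c.rel_biUnique _ _) (c.rel_biUnique _ _) (c.rel_biUnique _ _)
    ?_ ?_ ?_ ?_ a
  · rw [relRan_rel, relDom_rel, h.ran_eq_dom]
  · rw [relDom_rel, relDom_rel, h.dom_eq]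
  · rw [relRan_rel, relRan_rel, h.ran_eq, c.coherent p q r h]
  · rintro _ _ _ ⟨x, hx, hxi, rfl, rfl⟩ ⟨y, hy, hyi, hxy, rfl⟩
    refine ⟨x, h.dom_eq ▸ hx, hxi, rfl, ?_⟩
    rw [h.comp x hx, c.coherent p q r h, eq_comm]
    exact (c.g_map_eq_iff hy (h.ran_eq_dom ▸ p.maps_mem x hx) hyi ((c.mem_map hx i).2 hxi)).2 hxy

open Classical in
/-- The permutation of valuations over the vertex `x` induced by a partial isometry. -/
noncomputable def valPerm [Finite K] (p : PartialIsometry m) (x : 𝒲.V) : Equiv.Perm (I → K) :=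
  Equiv.piCongr (c.S p) fun i => if c.mem x i then extendPerm (c.rel p i) else 1

open Classical in
theorem valPerm_apply [Finite K] (p : PartialIsometry m) (x : 𝒲.V) (χ : I → K) (i : I) :
    c.valPerm p x χ (c.S p i) = (if c.mem x i then extendPerm (c.rel p i) else 1) (χ i) :=
  Equiv.piCongr_apply_apply _ _ _ _

open Classical in
/-- The witness of pairs `(x, χ)` of a vertex and a valuation, with edges satisfying all the
constraints. -/
noncomputable def cover [Finite I] [Finite K] [Inhabited K] : Witness m D where
  V := 𝒲.V × (I → K)
  finite := by have := 𝒲.finite; infer_instance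
  E x y d := 𝒲.E x.1 y.1 d ∧
    ∀ i, c.mem x.1 i → c.mem y.1 i → (x.2 i = y.2 i ↔ c.R i x.1 y.1 d)
  symm x y d h := ⟨𝒲.symm _ _ _ h.1, fun i hy hx => by
    rw [eq_comm, h.2 i hx hy]; exact ⟨c.R_symm i _ _ d, c.R_symm i _ _ d⟩⟩
  irrefl x d h := 𝒲.irrefl _ _ h.1
  pos x y d h := 𝒲.pos _ _ _ h.1
  le x y d h := 𝒲.le _ _ _ h.1
  ψ x := (𝒲.ψ x, fun i => if c.mem (𝒲.ψ x) i then c.g i x else default)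
  hom x y h := ⟨𝒲.hom x y h, fun i hx hy => by
    simp only [if_pos hx, if_pos hy]; exact c.g_eq_iff i x y h hx hy⟩
  T p := Equiv.prodShear (𝒲.T p) (c.valPerm p)
  aut p x y d := by
    refine and_congr (𝒲.aut p _ _ d) ?_
    rw [← (c.S p).forall_congr_right]
    refine forall_congr' fun i => ?_
    simp only [Equiv.prodShear_apply, c.mem_iff, c.valPerm_apply, c.R_iff]
    refine forall_congr' fun hx => forall_congr' fun hy => ?_
    simp [hx, hy]
  extends_f p x hx := by
    refine Prod.ext (𝒲.extends_f p x hx) (funext ?_)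
    rw [← (c.S p).forall_congr_right]
    intro i
    simp only [Equiv.prodShear_apply, c.valPerm_apply, c.mem_map hx]
    split_ifs with h
    · exact extendPerm_apply (c.rel_biUnique p i) ⟨x, hx, h, rfl, rfl⟩
    · rfl
  coherent p q r h x := by
    refine Prod.ext (𝒲.coherent p q r h x.1) (funext ?_)
    rw [← (c.S r).forall_congr_right]
    intro i
    simp only [Equiv.prodShear_apply, c.valPerm_apply]
    rw [c.coherent p q r h, c.valPerm_apply, c.valPerm_apply, c.mem_iff]
    split_ifs with hi
    · exact c.extendPerm_rel_comp h i _
    · rfl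

theorem metricBelow_cover [Finite I] [Finite K] [Inhabited K] {w : ℕ}
    (h : MetricBelow 𝒲.E w) : MetricBelow c.cover.E w :=
  fun _ _ s d hs hw he => h _ _ s d hs (hw.map (f := Prod.fst) fun _ _ _ h => h.1) he.1

end Constraint

/-- Vertices lying on a walk of weight `w` from `i.1` to `i.2`. -/
def OnWalk {V : Type u} (E : V → V → ℕ → Prop) (w : ℕ) (x : V) (i : V × V) : Prop :=
  ∃ s t, s + t = w ∧ Walk E i.1 x s ∧ Walk E x i.2 t

/-- The ordered pair `(x, y)` is, up to symmetry, the pair `i` and `d` exceeds `w`. -/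
def IsLong {V : Type u} (w : ℕ) (i : V × V) (x y : V) (d : ℕ) : Prop :=
  w < d ∧ (x = i.1 ∧ y = i.2 ∨ x = i.2 ∧ y = i.1)

theorem eq_of_mem_walk {𝒲 : Witness m D} {w : ℕ} (h : MetricBelow 𝒲.E w) {x₀ x y : A}
    (hw : w < m.natDist x₀ x) (hy : OnWalk 𝒲.E w (𝒲.ψ y) (𝒲.ψ x₀, 𝒲.ψ x)) :
    y = x₀ ∨ y = x := by
  by_contra! hne
  obtain ⟨s, t, hst, h₁, h₂⟩ := hy
  have hs : s ≠ 0 := by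
    rintro rfl
    exact hne.1 (𝒲.ψ_injective (h₁.eq_of_zero 𝒲.pos)).symm
  have ht : t ≠ 0 := by
    rintro rfl
    exact hne.2 (𝒲.ψ_injective (h₂.eq_of_zero 𝒲.pos))
  have h₃ := h _ _ s _ (by omega) h₁ (𝒲.hom _ _ hne.1.symm)
  have h₄ := h _ _ t _ (by omega) h₂ (𝒲.hom _ _ hne.2)
  have h₅ := m.natDist_triangle x₀ y x
  omega

open Classical in
/-- The constraint opening up all non-metric closed walks whose short part has weight `w`. -/
noncomputable def walkConstraint (𝒲 : Witness m D) {w : ℕ} (h : MetricBelow 𝒲.E w) :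
    Constraint 𝒲 (𝒲.V × 𝒲.V) (ULift.{u} Bool) where
  S p := (𝒲.T p).prodCongr (𝒲.T p)
  coherent p q r hc i := Prod.ext (𝒲.coherent p q r hc _) (𝒲.coherent p q r hc _)
  mem := OnWalk 𝒲.E w
  mem_iff p x i := by
    simp only [OnWalk, Equiv.prodCongr_apply, Prod.map, Walk.equiv_iff _ (𝒲.aut p)]
  R i x y d := ¬IsLong w i x y d
  R_symm i x y d h := by simp only [IsLong] at *; tauto
  R_iff p i x y d := by simp [IsLong]
  g i x := ⟨decide (𝒲.ψ x = i.2 ∧ ∃ x₀, 𝒲.ψ x₀ = i.1 ∧ w < m.natDist x₀ x)⟩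
  g_eq_iff := by
    have key : ∀ i x y, x ≠ y → OnWalk 𝒲.E w (𝒲.ψ y) i →
        (𝒲.ψ x = i.2 ∧ ∃ x₀, 𝒲.ψ x₀ = i.1 ∧ w < m.natDist x₀ x) →
        𝒲.ψ y = i.1 ∧ w < m.natDist y x := by
      rintro ⟨_, _⟩ x y hxy hy ⟨rfl, x₀, rfl, hw⟩
      rcases eq_of_mem_walk h hw hy with rfl | rfl
      · exact ⟨rfl, hw⟩
      · exact absurd rfl hxy
    intro i x y hxy hx hy
    simp only [ULift.up_inj, decide_eq_decide]
    have hsymm := m.natDist_symm x y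
    have hne := 𝒲.ψ_injective.ne hxy
    constructor
    · rintro heq ⟨hw, ⟨h₁, h₂⟩ | ⟨h₁, h₂⟩⟩
      · exact hne (((heq.2 ⟨h₂, x, h₁, hw⟩).1).trans h₂.symm)
      · exact hne (h₁.trans (heq.1 ⟨h₁, y, h₂, hsymm ▸ hw⟩).1.symm)
    · intro hR
      constructor <;> intro hg <;> exfalso
      · obtain ⟨h₁, h₂⟩ := key i x y hxy hy hg
        exact hR ⟨hsymm ▸ h₂, .inr ⟨hg.1, h₁⟩⟩
      · obtain ⟨h₁, h₂⟩ := key i y x hxy.symm hx hg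
        exact hR ⟨h₂, .inl ⟨h₁, hg.1⟩⟩

theorem val_eq_of_walk {𝒲 : Witness m D} {w : ℕ} (h : MetricBelow 𝒲.E w) {i : 𝒲.V × 𝒲.V}
    [Finite (𝒲.V × 𝒲.V)] {x y : (𝒲.walkConstraint h).cover.V} {t : ℕ}
    (hw : Walk (𝒲.walkConstraint h).cover.E x y t) :
    ∀ s s', s + t + s' = w → Walk 𝒲.E i.1 x.1 s → Walk 𝒲.E y.1 i.2 s' → x.2 i = y.2 i := by
  induction hw with
  | nil => intros; rfl
  | @cons x z y d t he hw ih =>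
    intro s s' hs h₁ h₂
    have hz : Walk 𝒲.E z.1 y.1 t := hw.map (f := Prod.fst) fun _ _ _ h => h.1
    have h₃ := h₁.append (.single he.1)
    refine ((he.2 i ⟨s, d + t + s', by omega, h₁, (Walk.cons he.1 hz).append h₂⟩
      ⟨s + d, t + s', by omega, h₃, hz.append h₂⟩).2 fun hl => ?_).trans
      (ih (s + d) s' (by omega) h₃ h₂)
    have := hl.1
    omega

theorem exists_metricBelow_succ (𝒲 : Witness m D) {w : ℕ} (h : MetricBelow 𝒲.E w) :
    ∃ 𝒲' : Witness m D, MetricBelow 𝒲'.E (w + 1) := by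
  have := 𝒲.finite
  refine ⟨(𝒲.walkConstraint h).cover, fun x y s d hs hw he => ?_⟩
  rcases Nat.lt_succ_iff_lt_or_eq.1 hs with hs | rfl
  · exact (𝒲.walkConstraint h).metricBelow_cover h x y s d hs hw he
  by_contra! hd
  have hw' : Walk 𝒲.E x.1 y.1 s := hw.map (f := Prod.fst) fun _ _ _ h => h.1
  have h₁ := val_eq_of_walk h (i := (x.1, y.1)) hw 0 0 (by omega) (.nil _) (.nil _)
  exact (he.2 (x.1, y.1) ⟨0, s, by omega, .nil _, hw'⟩ ⟨s, 0, by omega, hw', .nil _⟩).1 h₁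
    ⟨hd, .inl ⟨rfl, rfl⟩⟩

theorem exists_metricBelow [Finite A] (hD : ∀ x y, m.natDist x y ≤ D) (w : ℕ) :
    ∃ 𝒲 : Witness m D, MetricBelow 𝒲.E (w + 1) := by
  induction w with
  | zero => exact exists_initial hD
  | succ w ih => exact ih.elim fun 𝒲 h => 𝒲.exists_metricBelow_succ h

/-- The tuple `i` is a clique of edges with label `1`, and `x` belongs to it. -/
def OnClique {V : Type u} (E : V → V → ℕ → Prop) {n : ℕ} (x : V) (i : Fin n → V) : Prop :=
  (∀ j k, j ≠ k → E (i j) (i k) 1) ∧ ∃ j, i j = x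

theorem exists_clique_val (𝒲 : Witness m D) (h : MetricBelow 𝒲.E 2) {n : ℕ}
    (hm : ¬ContainsKn m (n + 1)) (hn : n ≠ 0) (i : Fin (n + 1) → 𝒲.V) :
    ∃ g : A → Fin n, ∀ x y, OnClique 𝒲.E (𝒲.ψ x) i → OnClique 𝒲.E (𝒲.ψ y) i →
      g x = g y → x = y := by
  classical
  have : NeZero n := ⟨hn⟩
  by_cases hi : ∀ j, ∃ x, OnClique 𝒲.E (𝒲.ψ x) i ∧ 𝒲.ψ x = i j
  · choose p hp hpi using hi
    have hE := fun j k hjk => (hp 0).1 j k hjk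
    refine absurd ⟨p, fun j k hjk => ?_, fun j k hjk => ?_⟩ hm
    · by_contra hne
      have := hE j k hne
      rw [← hpi, ← hpi, hjk] at this
      exact 𝒲.irrefl _ _ this
    · have he := hE j k hjk
      have hne : p j ≠ p k := by
        intro hjk
        rw [← hpi, ← hpi, hjk] at he
        exact 𝒲.irrefl _ _ he
      rw [← hpi, ← hpi] at he
      have h₁ := h _ _ 1 _ (by omega) (.single he) (𝒲.hom _ _ hne)
      have h₂ := m.natDist_pos hne
      rw [← m.natDist_cast]
      omega
  · push Not at hi
    obtain ⟨j, hj⟩ := hi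
    let e := finSuccAboveEquiv j
    refine ⟨fun x => if hx : ∃ k : {k // k ≠ j}, i k = 𝒲.ψ x then e.symm hx.choose else 0,
      fun x y hx hy hxy => ?_⟩
    have hex : ∀ x, OnClique 𝒲.E (𝒲.ψ x) i → ∃ k : {k // k ≠ j}, i k = 𝒲.ψ x := by
      rintro x hx
      obtain ⟨k, hk⟩ := hx.2
      exact ⟨⟨k, fun hkj => hj x hx (by rw [← hk, hkj])⟩, hk⟩
    simp only [dif_pos (hex x hx), dif_pos (hex y hy)] at hxy
    have := e.symm.injective hxy
    apply 𝒲.ψ_injective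
    rw [← (hex x hx).choose_spec, ← (hex y hy).choose_spec, this]

/-- The constraint destroying all cliques of `n + 1` vertices and edges with label `1`. -/
noncomputable def cliqueConstraint (𝒲 : Witness m D) (h : MetricBelow 𝒲.E 2) {n : ℕ}
    (hm : ¬ContainsKn m (n + 1)) (hn : n ≠ 0) :
    Constraint 𝒲 (Fin (n + 1) → 𝒲.V) (ULift.{u} (Fin n)) where
  S p := Equiv.arrowCongr (Equiv.refl _) (𝒲.T p)
  coherent p q r hc i := funext fun _ => 𝒲.coherent p q r hc _
  mem := OnClique 𝒲.E
  mem_iff p x i := by simp [OnClique, 𝒲.aut]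
  R i x y d := False
  R_symm i x y d h := h
  R_iff p i x y d := Iff.rfl
  g i x := ⟨(𝒲.exists_clique_val h hm hn i).choose x⟩
  g_eq_iff i x y hxy hx hy := by
    simp only [ULift.up_inj, iff_false]
    exact fun heq => hxy ((𝒲.exists_clique_val h hm hn i).choose_spec x y hx hy heq)

theorem exists_cliqueFree (𝒲 : Witness m D) {w n : ℕ} (h : MetricBelow 𝒲.E w) (hw : 2 ≤ w)
    (hm : ¬ContainsKn m (n + 1)) (hn : n ≠ 0) :
    ∃ 𝒲' : Witness m D, MetricBelow 𝒲'.E w ∧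
      ¬∃ i : Fin (n + 1) → 𝒲'.V, ∀ j k, j ≠ k → 𝒲'.E (i j) (i k) 1 := by
  have := 𝒲.finite
  have : NeZero n := ⟨hn⟩
  have h₂ : MetricBelow 𝒲.E 2 := fun x y s d hs => h x y s d (hs.trans_le hw)
  let c := 𝒲.cliqueConstraint h₂ hm hn
  refine ⟨c.cover, c.metricBelow_cover h, ?_⟩
  rintro ⟨i, hi⟩
  have hmem : ∀ j, OnClique 𝒲.E (i j).1 fun j => (i j).1 :=
    fun j => ⟨fun j k hjk => (hi j k hjk).1, j, rfl⟩
  obtain ⟨j, k, hjk, heq⟩ := Fintype.exists_ne_map_eq_of_card_lt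
    (fun j => ((i j).2 fun j => (i j).1).down) (by simp)
  exact ((hi j k hjk).2 _ (hmem j) (hmem k)).1 (ULift.down_injective heq)

theorem walkDist_ψ (𝒲 : Witness m D) (h : MetricBelow 𝒲.E D) (hD : ∀ x y, m.natDist x y ≤ D)
    (x y : A) : walkDist 𝒲.E D (𝒲.ψ x) (𝒲.ψ y) = m.natDist x y := by
  by_cases hxy : x = y
  · subst hxy
    have : m.natDist x x = 0 := by simp [IntMetric.natDist, (m.d_eq_zero_iff x x).2 rfl]
    rw [this]
    exact Nat.le_zero.1 (walkDist_le (.inl (.nil _)))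
  have he := 𝒲.hom x y hxy
  refine le_antisymm (walkDist_le (.inl (.single he))) ?_
  by_cases hlt : walkDist 𝒲.E D (𝒲.ψ x) (𝒲.ψ y) < D
  · exact h _ _ _ _ hlt ((walkDist_spec D _ _).resolve_right (by omega)) he
  · exact (hD x y).trans (not_lt.1 hlt)

theorem walkDist_T (𝒲 : Witness m D) (p : PartialIsometry m) (x y : 𝒲.V) :
    walkDist 𝒲.E D (𝒲.T p x) (𝒲.T p y) = walkDist 𝒲.E D x y := by
  simp only [walkDist, Walk.equiv_iff _ (𝒲.aut p)]

end Witness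

open Classical in
/-- The pullback of a partial isometry along an isometric embedding whose image contains its
domain and range. -/
noncomputable def PartialIsometry.comap {B : Type u} {mB : IntMetric B} {ψ : A → B}
    (hψ : ∀ x y, mB.d (ψ x) (ψ y) = m.d x y) (p : PartialIsometry mB)
    (hran : p.ran ⊆ Set.range ψ) (hdom : p.dom ⊆ Set.range ψ) : PartialIsometry m :=
  have hf : ∀ x, ψ x ∈ p.dom → ∃ y, ψ y = p.f (ψ x) := fun x hx => hran (p.maps_mem _ hx)
  have hinj : ∀ x y, ψ x = ψ y → x = y := fun x y h => by
    rw [← m.d_eq_zero_iff, ← hψ, mB.d_eq_zero_iff, h]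
  let f : A → A := fun x => if h : ∃ y, ψ y = p.f (ψ x) then h.choose else x
  have hfψ : ∀ x, ψ x ∈ p.dom → ψ (f x) = p.f (ψ x) := fun x hx => by
    simp only [f, dif_pos (hf x hx)]
    exact (hf x hx).choose_spec
  { dom := ψ ⁻¹' p.dom
    ran := ψ ⁻¹' p.ran
    f := f
    maps_mem := fun x hx => by
      rw [Set.mem_preimage, hfψ x hx]
      exact p.maps_mem _ hx
    injOn := fun x hx y hy h => hinj x y <| p.injOn _ hx _ hy <| by
      rw [← hfψ x hx, ← hfψ y hy, h]
    surjOn := fun y hy => by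
      obtain ⟨b, hb, hby⟩ := p.surjOn _ hy
      obtain ⟨x, rfl⟩ := hdom hb
      exact ⟨x, hb, hinj _ _ ((hfψ x hb).trans hby)⟩
    dist_eq := fun x hx y hy => by
      rw [← hψ, hfψ x hx, hfψ y hy, p.dist_eq _ hx _ hy, hψ] }

theorem PartialIsometry.comap_f {B : Type u} {mB : IntMetric B} {ψ : A → B}
    (hψ : ∀ x y, mB.d (ψ x) (ψ y) = m.d x y) (p : PartialIsometry mB)
    (hran : p.ran ⊆ Set.range ψ) (hdom : p.dom ⊆ Set.range ψ) {x : A} (hx : ψ x ∈ p.dom) :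
    ψ ((p.comap hψ hran hdom).f x) = p.f (ψ x) := by
  have h : ∃ y, ψ y = p.f (ψ x) := hran (p.maps_mem _ hx)
  simp only [comap, dif_pos h]
  exact h.choose_spec

end Coherent

/-- **Coherent EPPA for integer-valued metric spaces without `K_n`.** For `n ≥ 2`, the
class `M_n` of all finite integer-valued metric spaces containing no `n` points
pairwise at distance 1 has coherent EPPA: every `A ∈ M_n` admits an isometric
embedding `ψ` into some `B ∈ M_n` together with a coherent extension map sending
partial isometries of `ψ(A)` to self-isometries of `B`. -/
theorem integer_metric_spaces_no_Kn_coherent_eppa (n : ℕ) (hn : 2 ≤ n)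
    (A : Type u) [Finite A] (mA : IntMetric A) (hA : ¬ContainsKn mA n) :
    ∃ (B : Type u) (mB : IntMetric B), Finite B ∧ ¬ContainsKn mB n ∧
      ∃ ψ : A → B, (∀ x y, mB.d (ψ x) (ψ y) = mA.d x y) ∧
        ∃ ext : ∀ p : PartialIsometry mB,
            p.dom ⊆ Set.range ψ → p.ran ⊆ Set.range ψ → (B ≃ B),
          (∀ p h₁ h₂, ∀ x y : B, mB.d (ext p h₁ h₂ x) (ext p h₁ h₂ y) = mB.d x y) ∧
            (∀ p h₁ h₂, ∀ x ∈ p.dom, ext p h₁ h₂ x = p.f x) ∧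
            ∀ p q r hp₁ hp₂ hq₁ hq₂ hr₁ hr₂,
              p.dom = r.dom → p.ran = q.dom → q.ran = r.ran →
              (∀ x ∈ p.dom, r.f x = q.f (p.f x)) →
              ∀ x, ext r hr₁ hr₂ x = ext q hq₁ hq₂ (ext p hp₁ hp₂ x) := by
  obtain ⟨n, rfl⟩ : ∃ k, n = k + 1 := ⟨n - 1, by omega⟩
  obtain ⟨D, hD2, hD⟩ : ∃ D, 2 ≤ D ∧ ∀ x y, mA.natDist x y ≤ D := by
    obtain ⟨D, hD⟩ := (Set.finite_range fun z : A × A => mA.natDist z.1 z.2).bddAbove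
    exact ⟨max 2 D, le_max_left _ _,
      fun x y => (hD ⟨(x, y), rfl⟩).trans (le_max_right _ _)⟩
  obtain ⟨𝒲₀, h₀⟩ := Witness.exists_metricBelow hD D
  obtain ⟨𝒲, h, hclique⟩ := 𝒲₀.exists_cliqueFree h₀ (by omega) hA (by omega)
  let mB : IntMetric 𝒲.V := walkMetric (D := D) (by omega) 𝒲.pos 𝒲.symm
  have hψ : ∀ x y, mB.d (𝒲.ψ x) (𝒲.ψ y) = mA.d x y := fun x y => by
    rw [← mA.natDist_cast, ← 𝒲.walkDist_ψ (fun x y s d hs => h x y s d (by omega)) hD]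
    rfl
  refine ⟨𝒲.V, mB, 𝒲.finite, ?_, 𝒲.ψ, hψ,
    fun p h₁ h₂ => 𝒲.T (p.comap hψ h₂ h₁), ?_, ?_, ?_⟩
  · rintro ⟨i, -, hi⟩
    refine hclique ⟨i, fun j k hjk => ?_⟩
    have h₁ : walkDist 𝒲.E D (i j) (i k) = 1 := Nat.cast_injective (R := ℤ) (hi j k hjk)
    have h₂ := walkDist_spec (E := 𝒲.E) D (i j) (i k)
    rw [h₁] at h₂
    exact (h₂.resolve_right (by omega)).edge_of_one 𝒲.pos
  · intro p h₁ h₂ x y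
    exact congrArg Nat.cast (𝒲.walkDist_T _ x y)
  · intro p h₁ h₂ b hb
    obtain ⟨x, rfl⟩ := h₁ hb
    rw [𝒲.extends_f _ x hb, p.comap_f hψ h₂ h₁ hb]
  · intro p q r hp₁ hp₂ hq₁ hq₂ hr₁ hr₂ hpr hpq hqr hcomp
    refine 𝒲.coherent _ _ _ ⟨congrArg (𝒲.ψ ⁻¹' ·) hpr, congrArg (𝒲.ψ ⁻¹' ·) hpq,
      congrArg (𝒲.ψ ⁻¹' ·) hqr, fun x hx => ?_⟩
    apply 𝒲.ψ_injective
    have hx' : 𝒲.ψ x ∈ p.dom := hx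
    have hpx := p.comap_f hψ hp₂ hp₁ hx'
    rw [r.comap_f hψ hr₂ hr₁ (hpr ▸ hx'), q.comap_f hψ hq₂ hq₁, hpx, hcomp _ hx']
    rw [hpx, ← hpq]
    exact p.maps_mem _ hx'

end EPPA
end

section
/- Let G = (V, E) be a finite simple graph and d : E → ℕ₊ an assignment of positive integer lengths to its edges. Then there exists a metric d' on V with positive integer distances satisfying d'(x, y) = d({x,y}) for every edge {x,y} ∈ E if and only if G contains no non-metric cycle, that is, no sequence c₁, …, c_k of distinct vertices (k ≥ 3) such that consecutive pairs {c_i, c_{i+1}} (1 ≤ i < k) and {c₁, c_k} are all edges of G and d({c₁, c_k}) > Σ_{i=1}^{k−1} d({c_i, c_{i+1}}). Moreover, d' can be chosen so that every automorphism of the edge-labelled graph (G, d) is an isometry of (V, d'). -/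
set_option autoImplicit false

universe u

namespace EPPA

/-- `d'` is a metric on `V` with (positive) integer distances. -/
def IsIntegerMetric {V : Type u} (d' : V → V → ℕ) : Prop :=
  (∀ x y, d' x y = 0 ↔ x = y) ∧ (∀ x y, d' x y = d' y x) ∧
    ∀ x y z, d' x z ≤ d' x y + d' y z

/-- The edge-labelled graph `(G, d)` contains a non-metric cycle: distinct vertices
`c 0, …, c (k-1)` (`k ≥ 3`) such that consecutive pairs and `{c 0, c (k-1)}` are
edges and the label of `{c 0, c (k-1)}` exceeds the sum of the other labels. -/
def HasNonMetricCycle {V : Type u} (G : SimpleGraph V) (d : Sym2 V → ℕ) : Prop :=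
  ∃ (k : ℕ) (c : ℕ → V), 3 ≤ k ∧
    (∀ i < k, ∀ j < k, c i = c j → i = j) ∧
    (∀ i, i + 1 < k → G.Adj (c i) (c (i + 1))) ∧
    G.Adj (c 0) (c (k - 1)) ∧
    ∑ i ∈ Finset.range (k - 1), d s(c i, c (i + 1)) < d s(c 0, c (k - 1))

/-- The total label of a walk. -/
def walkLabel {V : Type u} {G : SimpleGraph V} (d : Sym2 V → ℕ) {x y : V}
    (p : G.Walk x y) : ℕ :=
  (p.edges.map d).sum

/-- The lengths competing for the distance of `x` and `y` in the shortest path completion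
with default distance `M`. -/
def completionLengths {V : Type u} (G : SimpleGraph V) (d : Sym2 V → ℕ) (M : ℕ)
    (x y : V) : Set ℕ :=
  {n | (x ≠ y ∧ n = M) ∨ ∃ p : G.Walk x y, walkLabel d p = n}

/-- The shortest path completion of `(G, d)` with default distance `M`. -/
noncomputable def completion {V : Type u} (G : SimpleGraph V) (d : Sym2 V → ℕ) (M : ℕ)
    (x y : V) : ℕ :=
  sInf (completionLengths G d M x y)

section

variable {V : Type u} {G : SimpleGraph V} {d : Sym2 V → ℕ} {M : ℕ}

theorem walkLabel_append {x y z : V} (p : G.Walk x y) (q : G.Walk y z) :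
    walkLabel d (p.append q) = walkLabel d p + walkLabel d q := by
  simp [walkLabel]

theorem walkLabel_reverse {x y : V} (p : G.Walk x y) :
    walkLabel d p.reverse = walkLabel d p := by
  simp [walkLabel, List.sum_reverse]

theorem walkLabel_eq_sum_getVert {x y : V} (p : G.Walk x y) :
    walkLabel d p = ∑ i ∈ Finset.range p.length, d s(p.getVert i, p.getVert (i + 1)) := by
  induction p with
  | nil => simp [walkLabel]
  | cons h p ih =>
    rw [SimpleGraph.Walk.length_cons, Finset.sum_range_succ']
    simp only [SimpleGraph.Walk.getVert_cons_succ, SimpleGraph.Walk.getVert_zero, ← ih]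
    simp [walkLabel, add_comm]

theorem walkLabel_map {V' : Type u} {G' : SimpleGraph V'} {d' : Sym2 V' → ℕ} (f : G →g G')
    (hf : ∀ x y, G.Adj x y → d' s(f x, f y) = d s(x, y)) {x y : V} (p : G.Walk x y) :
    walkLabel d' (p.map f) = walkLabel d p := by
  induction p with
  | nil => simp [walkLabel]
  | cons h p ih =>
    simp only [walkLabel, SimpleGraph.Walk.map_cons, SimpleGraph.Walk.edges_cons,
      List.map_cons, List.sum_cons] at ih ⊢
    rw [ih, hf _ _ h]

theorem walkLabel_pos (hpos : ∀ e ∈ G.edgeSet, 0 < d e) {x y : V} (hxy : x ≠ y)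
    (p : G.Walk x y) : 0 < walkLabel d p := by
  cases p with
  | nil => exact absurd rfl hxy
  | cons h p =>
    have := hpos _ ((SimpleGraph.mem_edgeSet G).2 h)
    simp only [walkLabel, SimpleGraph.Walk.edges_cons, List.map_cons, List.sum_cons]
    omega

theorem exists_isPath_walkLabel_le {x y : V} (p : G.Walk x y) :
    ∃ q : G.Walk x y, q.IsPath ∧ walkLabel d q ≤ walkLabel d p := by
  classical
  induction p with
  | nil => exact ⟨.nil, .nil, le_rfl⟩
  | @cons u v w h p ih =>
    obtain ⟨q, hq, hle⟩ := ih
    have hcons (r : G.Walk v w) : walkLabel d (.cons h r) = d s(u, v) + walkLabel d r := by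
      simp [walkLabel]
    by_cases hu : u ∈ q.support
    · refine ⟨q.dropUntil u hu, hq.dropUntil hu, ?_⟩
      have := walkLabel_append (d := d) (q.takeUntil u hu) (q.dropUntil u hu)
      rw [SimpleGraph.Walk.take_spec] at this
      rw [hcons]
      omega
    · refine ⟨.cons h q, hq.cons hu, ?_⟩
      rw [hcons, hcons]
      omega

theorem label_le_walkLabel (hG : ¬HasNonMetricCycle G d) {x y : V} (h : G.Adj x y)
    (p : G.Walk x y) : d s(x, y) ≤ walkLabel d p := by
  obtain ⟨q, hq, hle⟩ := exists_isPath_walkLabel_le (d := d) p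
  refine le_trans ?_ hle
  have hsum := walkLabel_eq_sum_getVert (d := d) q
  by_contra! hlt
  have hlen : q.length ≠ 0 := fun h0 => h.ne (SimpleGraph.Walk.eq_of_length_eq_zero h0)
  have hend := q.getVert_length
  by_cases h1 : q.length = 1
  · rw [h1] at hsum hend
    simp [hend] at hsum
    omega
  · refine hG ⟨q.length + 1, q.getVert, by omega, fun i hi j hj hij => ?_,
      fun i hi => q.adj_getVert_succ (by omega), ?_, ?_⟩
    · exact hq.getVert_injOn (by simp; omega) (by simp; omega) hij
    · simpa using h
    · simpa [← hsum] using hlt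

theorem completionLengths_nonempty (x y : V) : (completionLengths G d M x y).Nonempty := by
  by_cases h : x = y
  · subst h
    exact ⟨_, .inr ⟨.nil, rfl⟩⟩
  · exact ⟨M, .inl ⟨h, rfl⟩⟩

theorem completion_mem (x y : V) : completion G d M x y ∈ completionLengths G d M x y :=
  Nat.sInf_mem (completionLengths_nonempty x y)

theorem completion_le_walkLabel {x y : V} (p : G.Walk x y) :
    completion G d M x y ≤ walkLabel d p :=
  Nat.sInf_le (.inr ⟨p, rfl⟩)

theorem completion_self (x : V) : completion G d M x x = 0 := by
  simpa [walkLabel] using completion_le_walkLabel (d := d) (M := M) (.nil : G.Walk x x)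

theorem completion_le (x y : V) : completion G d M x y ≤ M := by
  by_cases h : x = y
  · subst h
    simp [completion_self]
  · exact Nat.sInf_le (.inl ⟨h, rfl⟩)

theorem completion_map_le {V' : Type u} {G' : SimpleGraph V'} {d' : Sym2 V' → ℕ}
    (f : G →g G') (hf : ∀ x y, G.Adj x y → d' s(f x, f y) = d s(x, y)) (x y : V) :
    completion G' d' M (f x) (f y) ≤ completion G d M x y := by
  rcases completion_mem (G := G) (d := d) (M := M) x y with ⟨-, h⟩ | ⟨p, hp⟩
  · exact (completion_le _ _).trans_eq h.symm
  · rw [← hp, ← walkLabel_map f hf p]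
    exact completion_le_walkLabel _

theorem completion_comm_le (x y : V) : completion G d M x y ≤ completion G d M y x := by
  rcases completion_mem (G := G) (d := d) (M := M) y x with ⟨-, h⟩ | ⟨p, hp⟩
  · exact (completion_le _ _).trans_eq h.symm
  · rw [← hp, ← walkLabel_reverse p]
    exact completion_le_walkLabel _

theorem isIntegerMetric_completion (hpos : ∀ e ∈ G.edgeSet, 0 < d e) (hM : 0 < M) :
    IsIntegerMetric (completion G d M) := by
  refine ⟨fun x y => ⟨fun h => ?_, ?_⟩,
    fun x y => (completion_comm_le x y).antisymm (completion_comm_le y x), fun x y z => ?_⟩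
  · by_contra hxy
    rcases completion_mem (G := G) (d := d) (M := M) x y with ⟨-, h'⟩ | ⟨p, hp⟩
    · omega
    · have := walkLabel_pos hpos hxy p
      omega
  · rintro rfl
    exact completion_self x
  · have hle := completion_le (G := G) (d := d) (M := M) x z
    rcases completion_mem (G := G) (d := d) (M := M) x y with ⟨-, h⟩ | ⟨p, hp⟩
    · omega
    rcases completion_mem (G := G) (d := d) (M := M) y z with ⟨-, h⟩ | ⟨q, hq⟩
    · omega
    rw [← hp, ← hq, ← walkLabel_append]
    exact completion_le_walkLabel _

theorem completion_eq_label (hG : ¬HasNonMetricCycle G d) {x y : V} (h : G.Adj x y)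
    (hM : d s(x, y) ≤ M) : completion G d M x y = d s(x, y) := by
  apply le_antisymm
  · simpa [walkLabel] using completion_le_walkLabel (d := d) (M := M) h.toWalk
  · rcases completion_mem (G := G) (d := d) (M := M) x y with ⟨-, h'⟩ | ⟨p, hp⟩
    · rwa [h']
    · exact hp ▸ label_le_walkLabel hG h p

theorem completion_iso (φ : G ≃g G) (hφ : ∀ x y, G.Adj x y → d s(φ x, φ y) = d s(x, y))
    (x y : V) : completion G d M (φ x) (φ y) = completion G d M x y := by
  refine le_antisymm (completion_map_le φ.toHom hφ x y) ?_
  have hsymm (a b : V) (hab : G.Adj a b) : d s(φ.symm a, φ.symm b) = d s(a, b) := by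
    simpa using (hφ _ _ (φ.symm.map_adj_iff.2 hab)).symm
  simpa using completion_map_le (M := M) φ.symm.toHom hsymm (φ x) (φ y)

theorem IsIntegerMetric.le_sum_range {d' : V → V → ℕ} (hd' : IsIntegerMetric d') (c : ℕ → V)
    (n : ℕ) : d' (c 0) (c n) ≤ ∑ i ∈ Finset.range n, d' (c i) (c (i + 1)) := by
  induction n with
  | zero => simp [(hd'.1 _ _).2 rfl]
  | succ n ih =>
    rw [Finset.sum_range_succ]
    exact (hd'.2.2 _ (c n) _).trans (by omega)

theorem IsIntegerMetric.not_hasNonMetricCycle {d' : V → V → ℕ} (hd' : IsIntegerMetric d')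
    (h : ∀ x y, G.Adj x y → d' x y = d s(x, y)) : ¬HasNonMetricCycle G d := by
  rintro ⟨k, c, -, -, hadj, hlast, hlt⟩
  have hle := hd'.le_sum_range c (k - 1)
  rw [h _ _ hlast, Finset.sum_congr rfl fun i hi =>
    h _ _ (hadj i (by have := Finset.mem_range.1 hi; omega))] at hle
  omega

end

/-- **The shortest path completion.** A finite edge-labelled graph `(G, d)` with
positive integer labels extends to an integer-valued metric on its vertex set agreeing
with `d` on edges if and only if it has no non-metric cycle; moreover, the metric can
be chosen so that every label-preserving automorphism of `(G, d)` is an isometry. -/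
theorem shortest_path_completion {V : Type u} [Fintype V] (G : SimpleGraph V)
    (d : Sym2 V → ℕ) (hpos : ∀ e ∈ G.edgeSet, 0 < d e) :
    ((∃ d' : V → V → ℕ, IsIntegerMetric d' ∧ ∀ x y, G.Adj x y → d' x y = d s(x, y)) ↔
        ¬HasNonMetricCycle G d) ∧
      (¬HasNonMetricCycle G d →
        ∃ d' : V → V → ℕ, IsIntegerMetric d' ∧
          (∀ x y, G.Adj x y → d' x y = d s(x, y)) ∧
          ∀ φ : G ≃g G, (∀ x y, G.Adj x y → d s(φ x, φ y) = d s(x, y)) →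
            ∀ x y, d' (φ x) (φ y) = d' x y) := by
  have key : ¬HasNonMetricCycle G d →
      ∃ d' : V → V → ℕ, IsIntegerMetric d' ∧
        (∀ x y, G.Adj x y → d' x y = d s(x, y)) ∧
        ∀ φ : G ≃g G, (∀ x y, G.Adj x y → d s(φ x, φ y) = d s(x, y)) →
          ∀ x y, d' (φ x) (φ y) = d' x y := by
    intro hG
    let M := max 2 (Finset.univ.sup fun p : V × V => d s(p.1, p.2))
    have hM (x y : V) : d s(x, y) ≤ M :=
      (Finset.le_sup (f := fun p : V × V => d s(p.1, p.2)) (Finset.mem_univ (x, y))).trans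
        (le_max_right _ _)
    exact ⟨completion G d M, isIntegerMetric_completion hpos (by simp [M]),
      fun x y h => completion_eq_label hG h (hM x y), completion_iso⟩
  refine ⟨⟨fun ⟨d', hd', h⟩ => hd'.not_hasNonMetricCycle h, fun hG => ?_⟩, key⟩
  obtain ⟨d', hd', h, -⟩ := key hG
  exact ⟨d', hd', h⟩

end EPPA
end
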